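/- Let V ∈ C¹(ℝ³; ℝ), ε > 0, and let (r, u) with r ∈ C¹, u ∈ C² be a solution of the effective equation ṙ = u, m(u)u̇ = −∇V(r) + ε a(u)ü + ε b(u, u̇) on an interval, with |u(t)| < 1 for all t. Then, with G_ε(r, u, w) = ℰ_s(u) + V(r) − ε (a(u)w)·u, one has the identity (d/dt) G_ε(r(t), u(t), u̇(t)) = −ε (e²/12π) [ 6 γ(u(t))⁸ (u(t)·u̇(t))² + γ(u(t))⁶ |u̇(t)|² ] for all t. In particular, t ↦ G_ε(r(t), u(t), u̇(t)) is nonincreasing. -/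

import Mathlib

open Real MeasureTheory Filter
open scoped RealInnerProductSpace

noncomputable section

abbrev E3 : Type := EuclideanSpace ℝ (Fin 3)

/-- relativistic factor γ(v) = (1 - |v|²)^{-1/2} -/
def gam (v : E3) : ℝ := (Real.sqrt (1 - ‖v‖ ^ 2))⁻¹

/-- the function appearing in the square brackets of the soliton momentum -/
def phiFun (s : ℝ) : ℝ :=
  if s = 0 then 1 / 3
  else 1 / (2 * s ^ 2 * (1 - s ^ 2)) - (1 / (4 * s ^ 3)) * Real.log ((1 + s) / (1 - s))

/-- m₀(v)w = γ w + γ³ (v·w) v -/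
def m0Vec (v w : E3) : E3 := gam v • w + (gam v ^ 3 * ⟪v, w⟫) • v

/-- m_f(v)w = 3 mₑ (φ(|v|) w + |v|⁻¹ φ'(|v|)(v·w) v), equal to mₑ • w at v = 0 -/
def mfVec (me : ℝ) (v w : E3) : E3 :=
  (3 * me * phiFun ‖v‖) • w + (3 * me * ‖v‖⁻¹ * deriv phiFun ‖v‖ * ⟪v, w⟫) • v

/-- m(v) = m₀(v) + m_f(v) -/
def mVec (me : ℝ) (v w : E3) : E3 := m0Vec v w + mfVec me v w

/-- a(v)w = (e²/12π)[γ⁴ w + 4 γ⁶ (v·w) v] -/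
def aVec (e : ℝ) (v w : E3) : E3 :=
  (e ^ 2 / (12 * π)) • (gam v ^ 4 • w + (4 * gam v ^ 6 * ⟪v, w⟫) • v)

/-- b(v,w) = (e²/4π)[2γ⁶(v·w)w + γ⁶|w|²v + 6γ⁸(v·w)²v] -/
def bVec (e : ℝ) (v w : E3) : E3 :=
  (e ^ 2 / (4 * π)) •
    ((2 * gam v ^ 6 * ⟪v, w⟫) • w + (gam v ^ 6 * ‖w‖ ^ 2) • v
      + (6 * gam v ^ 8 * ⟪v, w⟫ ^ 2) • v)

/-- soliton energy ℰ_s(v), extended by ℰ_s(0) = 0 -/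
def Es (me : ℝ) (v : E3) : ℝ :=
  if ‖v‖ = 0 then 0
  else gam v - 1 + 3 * me * ((2 - ‖v‖ ^ 2) / (2 * (1 - ‖v‖ ^ 2))
    - (1 / (2 * ‖v‖)) * Real.log ((1 + ‖v‖) / (1 - ‖v‖)))

/-- Lyapunov function G_ε(r, u, w) = ℰ_s(u) + V(r) − ε (a(u)w)·u -/
def GFun (e me ε : ℝ) (V : E3 → ℝ) (r u w : E3) : ℝ :=
  Es me u + V r - ε * ⟪aVec e u w, u⟫

lemma one_sub_norm_sq_pos {v : E3} (hv : ‖v‖ < 1) : 0 < 1 - ‖v‖ ^ 2 := by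
  nlinarith [norm_nonneg v]

lemma gam_sq_mul {v : E3} (hv : ‖v‖ < 1) : gam v ^ 2 * (1 - ‖v‖ ^ 2) = 1 := by
  have h := one_sub_norm_sq_pos hv
  rw [gam, inv_pow, Real.sq_sqrt h.le, inv_mul_cancel₀ h.ne']

lemma hasDerivAt_gam {u : ℝ → E3} {w : E3} {t : ℝ} (hu : HasDerivAt u w t) (hv : ‖u t‖ < 1) :
    HasDerivAt (fun s => gam (u s)) (gam (u t) ^ 3 * ⟪u t, w⟫) t := by
  have h := one_sub_norm_sq_pos hv
  have hs := Real.sqrt_pos.2 h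
  refine (((hu.norm_sq.const_sub 1).sqrt h.ne').inv hs.ne').congr_deriv ?_
  rw [gam]
  field_simp

lemma hasDerivAt_norm_of_ne_zero {u : ℝ → E3} {w : E3} {t : ℝ} (hu : HasDerivAt u w t)
    (h0 : u t ≠ 0) : HasDerivAt (fun s => ‖u s‖) (⟪u t, w⟫ / ‖u t‖) t := by
  have hn : 0 < ‖u t‖ := norm_pos_iff.2 h0
  have h := hu.norm_sq.sqrt (pow_pos hn 2).ne'
  simp only [Real.sqrt_sq (norm_nonneg _)] at h
  refine h.congr_deriv ?_
  field_simp

lemma hasDerivAt_log_ratio {s : ℝ} (h0 : 0 < s) (h1 : s < 1) :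
    HasDerivAt (fun x : ℝ => Real.log ((1 + x) / (1 - x))) (2 / (1 - s ^ 2)) s := by
  have hp : 1 + s ≠ 0 := by positivity
  have hm : 1 - s ≠ 0 := by linarith
  have hq : 1 - s ^ 2 ≠ 0 := by nlinarith
  refine ((((hasDerivAt_id s).const_add 1).div ((hasDerivAt_id s).const_sub 1) hm).log
    (div_ne_zero hp hm)).congr_deriv ?_
  simp only [id, Pi.div_apply]
  have : 1 - s ^ 2 = (1 + s) * (1 - s) := by ring
  rw [this]
  field_simp
  ring

lemma hasDerivAt_phiFun {s : ℝ} (h0 : 0 < s) (h1 : s < 1) :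
    HasDerivAt phiFun
      (-(1 - 2 * s ^ 2) / (s ^ 3 * (1 - s ^ 2) ^ 2)
        + 3 / (4 * s ^ 4) * Real.log ((1 + s) / (1 - s)) - 1 / (2 * s ^ 3 * (1 - s ^ 2))) s := by
  have hq : 1 - s ^ 2 ≠ 0 := by nlinarith
  have hs : s ≠ 0 := h0.ne'
  have hpow : HasDerivAt (fun x : ℝ => 2 * x ^ 2 * (1 - x ^ 2))
      (2 * (2 * s) * (1 - s ^ 2) + 2 * s ^ 2 * (-(2 * s))) s := by
    have h2 : HasDerivAt (fun x : ℝ => x ^ 2) (2 * s) s := by simpa using hasDerivAt_pow 2 s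
    exact (h2.const_mul 2).mul (h2.const_sub 1)
  have hcube : HasDerivAt (fun x : ℝ => 4 * x ^ 3) (4 * (3 * s ^ 2)) s := by
    simpa using (hasDerivAt_pow 3 s).const_mul 4
  have key := ((hasDerivAt_const s (1 : ℝ)).div hpow (by positivity)).sub
    (((hasDerivAt_const s (1 : ℝ)).div hcube (by positivity)).mul (hasDerivAt_log_ratio h0 h1))
  have hev : phiFun =ᶠ[nhds s] fun x : ℝ =>
      1 / (2 * x ^ 2 * (1 - x ^ 2)) - (1 / (4 * x ^ 3)) * Real.log ((1 + x) / (1 - x)) := by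
    filter_upwards [isOpen_ne.mem_nhds hs] with x hx
    exact if_neg hx
  refine (key.congr_of_eventuallyEq hev).congr_deriv ?_
  simp only [Pi.div_apply]
  field_simp
  ring

/-- The self-field part of the soliton energy, per unit of `3 * me`, as a function of the speed. -/
def fieldEnergy (s : ℝ) : ℝ :=
  if s = 0 then 0
  else (2 - s ^ 2) / (2 * (1 - s ^ 2)) - (1 / (2 * s)) * Real.log ((1 + s) / (1 - s))

lemma Es_eq (me : ℝ) (v : E3) : Es me v = gam v - 1 + 3 * me * fieldEnergy ‖v‖ := by
  by_cases h : ‖v‖ = 0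
  · simp [Es, fieldEnergy, gam, h]
  · simp [Es, fieldEnergy, h]

lemma hasDerivAt_fieldEnergy {s : ℝ} (h0 : 0 < s) (h1 : s < 1) :
    HasDerivAt fieldEnergy (s * (phiFun s + s * deriv phiFun s)) s := by
  have hq : 1 - s ^ 2 ≠ 0 := by nlinarith
  have hs : s ≠ 0 := h0.ne'
  have h2 : HasDerivAt (fun x : ℝ => x ^ 2) (2 * s) s := by simpa using hasDerivAt_pow 2 s
  have hlin : HasDerivAt (fun x : ℝ => 2 * x) 2 s := by
    simpa using (hasDerivAt_id s).const_mul 2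
  have key := ((h2.const_sub 2).div ((h2.const_sub 1).const_mul 2) (by positivity)).sub
    (((hasDerivAt_const s (1 : ℝ)).div hlin (by positivity)).mul (hasDerivAt_log_ratio h0 h1))
  have hev : fieldEnergy =ᶠ[nhds s] fun x : ℝ =>
      (2 - x ^ 2) / (2 * (1 - x ^ 2)) - (1 / (2 * x)) * Real.log ((1 + x) / (1 - x)) := by
    filter_upwards [isOpen_ne.mem_nhds hs] with x hx
    exact if_neg hx
  refine (key.congr_of_eventuallyEq hev).congr_deriv ?_
  rw [(hasDerivAt_phiFun h0 h1).deriv, phiFun, if_neg hs]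
  simp only [Pi.div_apply]
  field_simp
  ring

lemma abs_log_ratio_sub_le {s : ℝ} (h0 : 0 < s) (h1 : s < 1 / 2) :
    |Real.log ((1 + s) / (1 - s)) - 2 * s| ≤ 4 * s ^ 3 := by
  have hm := Real.abs_log_sub_add_sum_range_le (x := s) (by rw [abs_of_pos h0]; linarith) 2
  have hp := Real.abs_log_sub_add_sum_range_le (x := -s)
    (by rw [abs_neg, abs_of_pos h0]; linarith) 2
  rw [abs_neg] at hp
  rw [abs_of_pos h0] at hm hp
  have hb : s ^ 3 / (1 - s) ≤ 2 * s ^ 3 := by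
    rw [div_le_iff₀ (by linarith)]
    nlinarith [mul_pos (pow_pos h0 3) (by linarith : 0 < 1 - 2 * s)]
  norm_num [Finset.sum_range_succ] at hm hp
  rw [Real.log_div (by linarith) (by linarith)]
  rw [abs_le] at hm hp ⊢
  constructor <;> linarith [hm.1, hm.2, hp.1, hp.2]

lemma abs_fieldEnergy_le {s : ℝ} (h0 : 0 ≤ s) (h1 : s < 1 / 2) :
    |fieldEnergy s| ≤ 3 * s ^ 2 := by
  rcases h0.eq_or_lt with rfl | h0
  · simp [fieldEnergy]
  have hs : s ≠ 0 := h0.ne'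
  have hq : 0 < 1 - s ^ 2 := by nlinarith
  rw [fieldEnergy, if_neg hs]
  have hsplit : (2 - s ^ 2) / (2 * (1 - s ^ 2)) - (1 / (2 * s)) * Real.log ((1 + s) / (1 - s))
      = s ^ 2 / (2 * (1 - s ^ 2)) - (Real.log ((1 + s) / (1 - s)) - 2 * s) / (2 * s) := by
    field_simp
    ring
  rw [hsplit]
  have hA : |s ^ 2 / (2 * (1 - s ^ 2))| ≤ s ^ 2 := by
    rw [abs_of_nonneg (by positivity), div_le_iff₀ (by positivity)]
    nlinarith [mul_nonneg (sq_nonneg s) (by nlinarith : 0 ≤ 1 - 2 * s ^ 2)]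
  have hB : |(Real.log ((1 + s) / (1 - s)) - 2 * s) / (2 * s)| ≤ 2 * s ^ 2 := by
    rw [abs_div, abs_of_pos (by positivity : 0 < 2 * s), div_le_iff₀ (by positivity)]
    linarith [abs_log_ratio_sub_le h0 h1]
  linarith [abs_sub (s ^ 2 / (2 * (1 - s ^ 2)))
    ((Real.log ((1 + s) / (1 - s)) - 2 * s) / (2 * s))]

lemma hasFDerivAt_fieldEnergy_norm_zero :
    HasFDerivAt (fun v : E3 => fieldEnergy ‖v‖) (0 : E3 →L[ℝ] ℝ) 0 := by
  refine Asymptotics.IsBigO.hasFDerivAt (n := 2) ?_ one_lt_two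
  refine Asymptotics.IsBigO.of_bound 3 ?_
  filter_upwards [Metric.ball_mem_nhds (0 : E3) (by norm_num : (0 : ℝ) < 1 / 2)] with v hv
  simpa using abs_fieldEnergy_le (norm_nonneg v) (by simpa using hv)

lemma hasDerivAt_Es (me : ℝ) {u : ℝ → E3} {w : E3} {t : ℝ} (hu : HasDerivAt u w t)
    (hv : ‖u t‖ < 1) :
    HasDerivAt (fun s => Es me (u s)) ⟪u t, mVec me (u t) w⟫ t := by
  simp only [Es_eq]
  have hg := gam_sq_mul hv
  have hfield : HasDerivAt (fun s => fieldEnergy ‖u s‖)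
      (⟪u t, w⟫ * (phiFun ‖u t‖ + ‖u t‖ * deriv phiFun ‖u t‖)) t := by
    by_cases h0 : u t = 0
    · have h := hasFDerivAt_fieldEnergy_norm_zero
      rw [← h0] at h
      simpa [h0, Function.comp_def] using h.comp_hasDerivAt t hu
    · have hn : 0 < ‖u t‖ := norm_pos_iff.2 h0
      refine ((hasDerivAt_fieldEnergy hn hv).comp t
        (hasDerivAt_norm_of_ne_zero hu h0)).congr_deriv ?_
      field_simp
  refine (((hasDerivAt_gam hu hv).sub_const 1).add (hfield.const_mul (3 * me))).congr_deriv ?_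
  simp only [mVec, m0Vec, mfVec, inner_add_right, inner_smul_right, real_inner_self_eq_norm_sq]
  by_cases h0 : u t = 0
  · simp [h0]
  · have hn : ‖u t‖ ≠ 0 := norm_ne_zero_iff.2 h0
    field_simp
    linear_combination gam (u t) * ⟪u t, w⟫ * hg

lemma inner_aVec (e : ℝ) {v : E3} (hv : ‖v‖ < 1) (w : E3) :
    ⟪v, aVec e v w⟫ = e ^ 2 / (12 * π) * ((4 * gam v ^ 6 - 3 * gam v ^ 4) * ⟪v, w⟫) := by
  simp only [aVec, inner_add_right, inner_smul_right, real_inner_self_eq_norm_sq]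
  linear_combination -(e ^ 2 / (12 * π)) * 4 * gam v ^ 4 * ⟪v, w⟫ * gam_sq_mul hv

lemma inner_bVec (e : ℝ) {v : E3} (hv : ‖v‖ < 1) (w : E3) :
    ⟪v, bVec e v w⟫ = e ^ 2 / (12 * π) * ((18 * gam v ^ 8 - 12 * gam v ^ 6) * ⟪v, w⟫ ^ 2
      + 3 * (gam v ^ 6 - gam v ^ 4) * ‖w‖ ^ 2) := by
  have hC : e ^ 2 / (4 * π) = 3 * (e ^ 2 / (12 * π)) := by
    field_simp
    ring
  simp only [bVec, inner_add_right, inner_smul_right, real_inner_self_eq_norm_sq, hC]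
  linear_combination -(e ^ 2 / (12 * π)) * (3 * gam v ^ 4 * ‖w‖ ^ 2
    + 18 * gam v ^ 6 * ⟪v, w⟫ ^ 2) * gam_sq_mul hv

/-- along any solution of the effective equation
ṙ = u, m(u)u̇ = −∇V(r) + ε a(u)ü + ε b(u, u̇) on an interval with |u| < 1, the Lyapunov
function G_ε(r, u, u̇) has derivative −ε(e²/12π)[6γ(u)⁸(u·u̇)² + γ(u)⁶|u̇|²]; in particular
it is nonincreasing on the interval. -/
theorem lyapunov_identity
    (e me ε : ℝ) (he : e ≠ 0) (hme : 0 ≤ me) (hε : 0 < ε)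
    (V : E3 → ℝ) (hV : ContDiff ℝ 1 V)
    (t₀ t₁ : ℝ) (r u u' u'' : ℝ → E3)
    (hr : ∀ t ∈ Set.Ioo t₀ t₁, HasDerivAt r (u t) t)
    (hu : ∀ t ∈ Set.Ioo t₀ t₁, HasDerivAt u (u' t) t)
    (hu' : ∀ t ∈ Set.Ioo t₀ t₁, HasDerivAt u' (u'' t) t)
    (hlt : ∀ t ∈ Set.Ioo t₀ t₁, ‖u t‖ < 1)
    (heq : ∀ t ∈ Set.Ioo t₀ t₁,
      mVec me (u t) (u' t)
        = -gradient V (r t) + ε • aVec e (u t) (u'' t) + ε • bVec e (u t) (u' t)) :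
    (∀ t ∈ Set.Ioo t₀ t₁,
      HasDerivAt (fun s => GFun e me ε V (r s) (u s) (u' s))
        (-(ε * (e ^ 2 / (12 * π))
          * (6 * gam (u t) ^ 8 * ⟪u t, u' t⟫ ^ 2 + gam (u t) ^ 6 * ‖u' t‖ ^ 2))) t)
    ∧ AntitoneOn (fun s => GFun e me ε V (r s) (u s) (u' s)) (Set.Ioo t₀ t₁) := by
  have hderiv : ∀ t ∈ Set.Ioo t₀ t₁,
      HasDerivAt (fun s => GFun e me ε V (r s) (u s) (u' s))
        (-(ε * (e ^ 2 / (12 * π))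
          * (6 * gam (u t) ^ 8 * ⟪u t, u' t⟫ ^ 2 + gam (u t) ^ 6 * ‖u' t‖ ^ 2))) t := by
    intro t ht
    have hv := hlt t ht
    have hgrad := ((hV.differentiable one_ne_zero) (r t)).hasGradientAt.hasFDerivAt.comp_hasDerivAt
      t (hr t ht)
    have hgam := hasDerivAt_gam (hu t ht) hv
    have hfriction := (((((hgam.pow 6).const_mul 4).sub ((hgam.pow 4).const_mul 3)).mul
      ((hu t ht).inner ℝ (hu' t ht))).const_mul (e ^ 2 / (12 * π))).const_mul ε
    have hev : (fun s => GFun e me ε V (r s) (u s) (u' s)) =ᶠ[nhds t] fun s =>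
        Es me (u s) + V (r s) - ε * (e ^ 2 / (12 * π)
          * ((4 * gam (u s) ^ 6 - 3 * gam (u s) ^ 4) * ⟪u s, u' s⟫)) := by
      filter_upwards [isOpen_Ioo.mem_nhds ht] with s hs
      rw [GFun, real_inner_comm, inner_aVec e (hlt s hs)]
    refine ((((hasDerivAt_Es me (hu t ht) hv).add hgrad).sub hfriction).congr_of_eventuallyEq
      hev).congr_deriv ?_
    have hforce := congrArg (fun x => ⟪u t, x⟫) (heq t ht)
    simp only [inner_add_right, inner_neg_right, inner_smul_right, inner_aVec e hv,
      inner_bVec e hv] at hforce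
    simp only [InnerProductSpace.toDual_apply_apply, real_inner_comm (u t) (gradient V (r t)),
      real_inner_self_eq_norm_sq, Pi.pow_apply, Pi.sub_apply, Pi.mul_apply] at *
    rw [hforce]
    push_cast
    ring
  refine ⟨hderiv, antitoneOn_of_hasDerivWithinAt_nonpos (convex_Ioo t₀ t₁)
    (fun t ht => (hderiv t ht).continuousAt.continuousWithinAt)
    (fun t ht => (hderiv t (interior_subset ht)).hasDerivWithinAt) fun t _ => ?_⟩
  exact neg_nonpos.2 (by positivity)
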